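/- arXiv:2308.16277 — 2 statements merged into one kernel-verified Lean document; each statement's English description precedes it below -/
import Mathlib

section
/- Let (S, Λ) be a spectral pair in ℤ_n and let q be a prime with q^2 ∣ n. If some coset of the unique subgroup of ℤ_n of order q^2 contains at least q + 1 elements of S, then Φ_q ∣ m_Λ and Φ_{q^2} ∣ m_Λ, and consequently q^2 divides |S|. -/
open Polynomial

/-- `(S, Λ)` is a spectral pair in `ℤ_n = ZMod n`. -/
def SpectralPair (n : ℕ) (S Λ : Finset (ZMod n)) : Prop :=
  Λ.card = S.card ∧
    ∀ lam ∈ Λ, ∀ mu ∈ Λ, lam ≠ mu →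
      ∑ s ∈ S, Complex.exp (2 * Real.pi * Complex.I *
        (((lam - mu).val * s.val : ℕ) : ℂ) / (n : ℂ)) = 0

/-- The mask polynomial of a subset `S` of `ZMod n`. -/
noncomputable def maskPoly (n : ℕ) (S : Finset (ZMod n)) : Polynomial ℤ :=
  ∑ s ∈ S, Polynomial.X ^ s.val

lemma spectral_stdAddChar (n : ℕ) [NeZero n] (a b : ZMod n) :
    Complex.exp (2 * Real.pi * Complex.I * ((a.val * b.val : ℕ) : ℂ) / (n : ℂ))
      = ZMod.stdAddChar (a * b) := by
  have := ZMod.stdAddChar_coe (N := n) ((a.val * b.val : ℕ) : ℤ)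
  have e : (((a.val * b.val : ℕ) : ℤ) : ZMod n) = a * b := by
    push_cast
    simp
  rw [e] at this
  rw [this]
  push_cast
  rfl

lemma spectral_dual (n : ℕ) [NeZero n] (S Λ : Finset (ZMod n)) (h : SpectralPair n S Λ)
    (s t : ZMod n) (hs : s ∈ S) (ht : t ∈ S) (hst : s ≠ t) :
    ∑ l ∈ Λ, (ZMod.stdAddChar (l * (s - t)) : ℂ) = 0 := by
  obtain ⟨hc, ho⟩ := h
  simp only [spectral_stdAddChar] at ho
  have hN : (S.card : ℂ) ≠ 0 := by
    have : S.card ≠ 0 := Finset.card_ne_zero_of_mem hs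
    exact_mod_cast this
  let A : Matrix Λ S ℂ := fun l s => ZMod.stdAddChar (l.1 * s.1)
  let B : Matrix S Λ ℂ := fun s l => (S.card : ℂ)⁻¹ * ZMod.stdAddChar (-(l.1 * s.1))
  have hAB : A * B = 1 := by
    ext l m
    have e : (A * B) l m = (S.card : ℂ)⁻¹ * ∑ s ∈ S, ZMod.stdAddChar ((l.1 - m.1) * s) := by
      rw [Matrix.mul_apply, Finset.mul_sum, ← Finset.sum_coe_sort S]
      refine Finset.sum_congr rfl fun s _ => ?_
      simp only [A, B]
      rw [sub_mul, sub_eq_add_neg, AddChar.map_add_eq_mul]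
      ring
    rw [e]
    by_cases hlm : l = m
    · subst hlm
      simp [hN]
    · rw [Matrix.one_apply_ne hlm, ho l l.2 m m.2 (fun h => hlm (Subtype.ext h)), mul_zero]
  have hBA : B * A = 1 := (Matrix.mul_eq_one_comm_of_card_eq _ _ _ (by simp [hc])).1 hAB
  have e : (B * A) ⟨t, ht⟩ ⟨s, hs⟩ = (S.card : ℂ)⁻¹ * ∑ l ∈ Λ, ZMod.stdAddChar (l * (s - t)) := by
    rw [Matrix.mul_apply, Finset.mul_sum, ← Finset.sum_coe_sort Λ]
    refine Finset.sum_congr rfl fun l _ => ?_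
    simp only [A, B]
    rw [mul_sub, sub_eq_add_neg, AddChar.map_add_eq_mul]
    ring
  rw [hBA, Matrix.one_apply_ne (fun h => hst (congrArg Subtype.val h).symm)] at e
  simpa [hN] using e.symm

lemma spectral_cyclotomic_dvd (n : ℕ) [NeZero n] (Λ : Finset (ZMod n)) (d : ZMod n)
    (hd : ∑ l ∈ Λ, (ZMod.stdAddChar (l * d) : ℂ) = 0) :
    cyclotomic (addOrderOf d) ℤ ∣ maskPoly n Λ := by
  have hpos : 0 < addOrderOf d := addOrderOf_pos d
  have hz : IsPrimitiveRoot (ZMod.stdAddChar d : ℂ) (addOrderOf d) := by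
    refine ⟨?_, fun k hk => ?_⟩
    · rw [← AddChar.map_nsmul_eq_pow, addOrderOf_nsmul_eq_zero, AddChar.map_zero_eq_one]
    · rw [← AddChar.map_nsmul_eq_pow, ← AddChar.map_zero_eq_one (ZMod.stdAddChar (N := n))] at hk
      exact addOrderOf_dvd_of_nsmul_eq_zero (ZMod.injective_stdAddChar hk)
  rw [cyclotomic_eq_minpoly hz hpos]
  refine minpoly.isIntegrallyClosed_dvd (hz.isIntegral hpos) ?_
  rw [maskPoly, map_sum, ← hd]
  refine Finset.sum_congr rfl fun l _ => ?_
  rw [map_pow, aeval_X, ← AddChar.map_nsmul_eq_pow, nsmul_eq_mul, ZMod.natCast_zmod_val]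

lemma spectral_torsion_card (n q : ℕ) [NeZero n] (hq : 0 < q) (U : Finset (ZMod n))
    (hU : ∀ u ∈ U, q • u = 0) : U.card ≤ q := by
  classical
  refine le_trans (Finset.card_le_card ?_) (IsAddCyclic.card_nsmul_eq_zero_le (α := ZMod n) hq)
  intro u hu
  simpa using hU u hu

theorem pigeonhole_q2_coset
    (n q : ℕ) (hn : 1 ≤ n) (hq : q.Prime) (hq2 : q ^ 2 ∣ n)
    (S Λ : Finset (ZMod n)) (h : SpectralPair n S Λ)
    (H : AddSubgroup (ZMod n)) (hH : Nat.card H = q ^ 2)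
    (hx : ∃ (x : ZMod n) (T : Finset (ZMod n)),
      T ⊆ S ∧ (∀ s ∈ T, s - x ∈ H) ∧ q + 1 ≤ T.card) :
    cyclotomic q ℤ ∣ maskPoly n Λ ∧
    cyclotomic (q ^ 2) ℤ ∣ maskPoly n Λ ∧
    q ^ 2 ∣ S.card := by
  classical
  have : NeZero n := ⟨by omega⟩
  have : Fact q.Prime := ⟨hq⟩
  obtain ⟨x, T, hTS, hT, hcard⟩ := hx
  have hHk : ∀ y ∈ H, q ^ 2 • y = 0 := by
    intro y hy
    have : Nat.card H • (⟨y, hy⟩ : H) = 0 := card_nsmul_eq_zero'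
    rw [hH] at this
    simpa using congrArg Subtype.val this
  -- a pair whose difference has order `q`
  have h1 : cyclotomic q ℤ ∣ maskPoly n Λ := by
    have hlt : (T.image fun s => q • (s - x)).card < T.card := by
      refine lt_of_le_of_lt (spectral_torsion_card n q hq.pos _ ?_) hcard
      intro u hu
      obtain ⟨s, hs, rfl⟩ := Finset.mem_image.1 hu
      rw [← mul_nsmul, ← pow_two]
      exact hHk _ (hT s hs)
    obtain ⟨s, hs, t, ht, hst, he⟩ := Finset.exists_ne_map_eq_of_card_image_lt hlt
    have ho : addOrderOf (s - t) = q := by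
      refine addOrderOf_eq_prime ?_ (sub_ne_zero.2 hst)
      rw [← sub_sub_sub_cancel_right s t x, nsmul_sub]
      exact sub_eq_zero.2 he
    have := spectral_cyclotomic_dvd n Λ (s - t) (spectral_dual n S Λ h s t (hTS hs) (hTS ht) hst)
    rwa [ho] at this
  -- a pair whose difference has order `q ^ 2`
  have h2 : cyclotomic (q ^ 2) ℤ ∣ maskPoly n Λ := by
    obtain ⟨t, ht⟩ : T.Nonempty := Finset.card_pos.1 (by omega)
    have : ∃ s ∈ T, q • (s - t) ≠ 0 := by
      by_contra! hcon
      have h3 := spectral_torsion_card n q hq.pos (T.image fun s => s - t) (by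
        intro u hu
        obtain ⟨s, hs, rfl⟩ := Finset.mem_image.1 hu
        exact hcon s hs)
      rw [Finset.card_image_of_injective _ (sub_left_injective)] at h3
      omega
    obtain ⟨s, hs, hne⟩ := this
    have hst : s ≠ t := by
      rintro rfl
      simp at hne
    have ho : addOrderOf (s - t) = q ^ (1 + 1) := by
      refine addOrderOf_eq_prime_pow (by simpa using hne) ?_
      refine hHk _ ?_
      rw [← sub_sub_sub_cancel_right s t x]
      exact H.sub_mem (hT s hs) (hT t ht)
    have := spectral_cyclotomic_dvd n Λ (s - t) (spectral_dual n S Λ h s t (hTS hs) (hTS ht) hst)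
    rwa [ho] at this
  refine ⟨h1, h2, ?_⟩
  have hne : q ≠ q ^ 2 := by nlinarith [hq.two_le]
  have hrel : IsRelPrime (cyclotomic q ℤ) (cyclotomic (q ^ 2) ℤ) := by
    refine ((cyclotomic.irreducible hq.pos).isRelPrime_iff_not_dvd).2 fun hd => ?_
    have ha := (cyclotomic.irreducible hq.pos).associated_of_dvd
      (cyclotomic.irreducible (pow_pos hq.pos 2)) hd
    exact hne (cyclotomic_injective (R := ℤ)
      (eq_of_monic_of_associated (cyclotomic.monic _ _) (cyclotomic.monic _ _) ha))
  obtain ⟨P, hP⟩ := hrel.mul_dvd h1 h2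
  have hev := congrArg (eval 1) hP
  rw [eval_mul, eval_mul, eval_one_cyclotomic_prime,
    show q ^ 2 = q ^ (1 + 1) from rfl, eval_one_cyclotomic_prime_pow] at hev
  have hm : eval 1 (maskPoly n Λ) = (S.card : ℤ) := by
    simp [maskPoly, eval_finsetSum, h.1]
  rw [hm] at hev
  have : ((q ^ 2 : ℕ) : ℤ) ∣ (S.card : ℤ) := ⟨eval 1 P, by rw [hev]; push_cast; ring⟩
  exact_mod_cast this
end

section
/- Let p, q, r be distinct primes and let (S, Λ) be a spectral pair in ℤ_{p^2 q^2 r}. If gcd(|S|, p^2 q^2 r) = p^2 q r (i.e. p^2 q r divides |S| but neither p^2 q^2 r, p^2 q^2, nor q^2 divides the gcd), then S tiles ℤ_{p^2 q^2 r}. -/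
/-- `S` tiles `ZMod n`. -/
def IsTile (n : ℕ) (S : Finset (ZMod n)) : Prop :=
  ∃ T : Finset (ZMod n), ∀ g : ZMod n,
    ∃! st : ZMod n × ZMod n, st.1 ∈ S ∧ st.2 ∈ T ∧ st.1 + st.2 = g

lemma aux_exp (n : ℕ) [NeZero n] (a s : ZMod n) :
    Complex.exp (2 * Real.pi * Complex.I * ((a.val * s.val : ℕ) : ℂ) / (n : ℂ))
      = ZMod.stdAddChar (a * s) := by
  have h := ZMod.stdAddChar_coe (N := n) ((a.val * s.val : ℕ) : ℤ)
  have e : (((a.val * s.val : ℕ) : ℤ) : ZMod n) = a * s := by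
    push_cast
    simp
  rw [e] at h
  rw [h]
  push_cast
  rfl

/-- The dual orthogonality relations. -/
lemma aux_dual (n : ℕ) [NeZero n] (S L : Finset (ZMod n)) (h : SpectralPair n S L)
    (s t : ZMod n) (hs : s ∈ S) (ht : t ∈ S) (hst : s ≠ t) :
    ∑ l ∈ L, (ZMod.stdAddChar ((s - t) * l) : ℂ) = 0 := by
  obtain ⟨hc, ho⟩ := h
  have hS : (S.card : ℂ) ≠ 0 := by
    have : 0 < S.card := Finset.card_pos.mpr ⟨s, hs⟩
    exact_mod_cast this.ne'
  let A : Matrix L S ℂ := fun l s => ZMod.stdAddChar (l.1 * s.1)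
  let B : Matrix S L ℂ := fun s l => (S.card : ℂ)⁻¹ * ZMod.stdAddChar (-(l.1 * s.1))
  have hAB : A * B = 1 := by
    ext l m
    rw [Matrix.mul_apply]
    have e : ∀ x : S, A l x * B x m
        = (S.card : ℂ)⁻¹ * ZMod.stdAddChar ((l.1 - m.1) * x.1) := by
      intro x
      simp only [A, B]
      rw [mul_left_comm, ← AddChar.map_add_eq_mul]
      congr 2
      ring
    rw [Finset.sum_congr rfl (fun x _ => e x), ← Finset.mul_sum,
      Finset.sum_coe_sort S (fun x => (ZMod.stdAddChar ((l.1 - m.1) * x) : ℂ))]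
    by_cases hlm : l = m
    · subst hlm
      simp [hS]
    · have h1 := ho l.1 l.2 m.1 m.2 (fun hh => hlm (Subtype.ext hh))
      simp only [aux_exp] at h1
      rw [h1, Matrix.one_apply_ne hlm, mul_zero]
  have hBA : B * A = 1 := by
    have e : L ≃ S := Fintype.equivOfCardEq (by simpa using hc)
    exact (Matrix.mul_eq_one_comm_of_equiv e).mp hAB
  have h2 := congrFun (congrFun hBA ⟨t, ht⟩) ⟨s, hs⟩
  rw [Matrix.mul_apply, Matrix.one_apply_ne (by simpa using hst.symm)] at h2
  have e : ∀ l : L, B ⟨t, ht⟩ l * A l ⟨s, hs⟩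
      = (S.card : ℂ)⁻¹ * ZMod.stdAddChar ((s - t) * l.1) := by
    intro x
    simp only [A, B]
    rw [mul_assoc, ← AddChar.map_add_eq_mul]
    congr 2
    ring
  rw [Finset.sum_congr rfl (fun x _ => e x), ← Finset.mul_sum,
    Finset.sum_coe_sort L (fun x => (ZMod.stdAddChar ((s - t) * x) : ℂ))] at h2
  exact (mul_eq_zero.mp h2).resolve_left (inv_ne_zero hS)

open Polynomial in
lemma aux_cyc (n : ℕ) [NeZero n] (L : Finset (ZMod n)) (a : ZMod n) (k : ℕ) (hk : 0 < k)
    (ha : IsPrimitiveRoot (ZMod.stdAddChar a : ℂ) k)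
    (h0 : ∑ l ∈ L, (ZMod.stdAddChar (a * l) : ℂ) = 0) :
    cyclotomic k ℤ ∣ ∑ l ∈ L, (X : ℤ[X]) ^ l.val := by
  rw [cyclotomic_eq_minpoly ha hk]
  apply minpoly.isIntegrallyClosed_dvd (ha.isIntegral hk)
  rw [map_sum, ← h0]
  refine Finset.sum_congr rfl fun l _ => ?_
  rw [map_pow, aeval_X, ← AddChar.map_nsmul_eq_pow]
  congr 1
  rw [nsmul_eq_mul, ZMod.natCast_zmod_val, mul_comm]

open Polynomial in
/-- Both an order `q` and an order `q ^ 2` zero force `q ^ 2` to divide the size. -/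
lemma aux_dvd (n q : ℕ) [NeZero n] (hq : q.Prime) (L : Finset (ZMod n)) (a b : ZMod n)
    (ha : a ≠ 0) (hqa : (q : ZMod n) * a = 0)
    (hb : (q : ZMod n) * b ≠ 0) (hqb : ((q ^ 2 : ℕ) : ZMod n) * b = 0)
    (h0 : ∑ l ∈ L, (ZMod.stdAddChar (a * l) : ℂ) = 0)
    (h1 : ∑ l ∈ L, (ZMod.stdAddChar (b * l) : ℂ) = 0) : q ^ 2 ∣ L.card := by
  have := Fact.mk hq
  have key : ∀ (k : ℕ) (c : ZMod n),
      (ZMod.stdAddChar c : ℂ) ^ k = 1 ↔ (k : ZMod n) * c = 0 := by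
    intro k c
    rw [← AddChar.map_nsmul_eq_pow, nsmul_eq_mul]
    constructor
    · intro h
      exact ZMod.injective_stdAddChar (by rw [h, AddChar.map_zero_eq_one])
    · intro h
      rw [h, AddChar.map_zero_eq_one]
  have pa : IsPrimitiveRoot (ZMod.stdAddChar a : ℂ) q := by
    have : orderOf (ZMod.stdAddChar a : ℂ) = q := by
      apply orderOf_eq_prime ((key q a).mpr hqa)
      intro h
      exact ha (ZMod.injective_stdAddChar (by rw [h, AddChar.map_zero_eq_one]))
    rw [← this]
    exact IsPrimitiveRoot.orderOf _
  have pb : IsPrimitiveRoot (ZMod.stdAddChar b : ℂ) (q ^ 2) := by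
    have : orderOf (ZMod.stdAddChar b : ℂ) = q ^ (1 + 1) := by
      apply orderOf_eq_prime_pow
      · rw [key, pow_one]
        exact hb
      · rw [key]
        exact hqb
    rw [show q ^ 2 = q ^ (1 + 1) from rfl, ← this]
    exact IsPrimitiveRoot.orderOf _
  have d1 := aux_cyc n L a q hq.pos pa h0
  obtain ⟨G, hG⟩ := aux_cyc n L b (q ^ 2) (pow_pos hq.pos 2) pb h1
  have hne : q ≠ q ^ 2 := by
    have := hq.one_lt
    nlinarith
  have hprime : Prime (cyclotomic q ℤ) := (cyclotomic.irreducible hq.pos).prime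
  rw [hG] at d1
  have d2 : cyclotomic q ℤ ∣ G := by
    refine (hprime.dvd_or_dvd d1).resolve_left ?_
    intro hd
    have hass := (cyclotomic.irreducible hq.pos).associated_of_dvd
      (cyclotomic.irreducible (pow_pos hq.pos 2)) hd
    have := eq_of_monic_of_associated (cyclotomic.monic q ℤ) (cyclotomic.monic (q ^ 2) ℤ) hass
    exact hne (cyclotomic_injective this)
  obtain ⟨H, rfl⟩ := d2
  have hev := congrArg (eval 1) hG
  have e1 : eval 1 (cyclotomic q ℤ) = q := eval_one_cyclotomic_prime
  have e2 : eval 1 (cyclotomic (q ^ 2) ℤ) = q := eval_one_cyclotomic_prime_pow 1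
  rw [eval_mul, eval_mul, e1, e2, eval_finsetSum] at hev
  simp only [eval_pow, eval_X, one_pow, Finset.sum_const, nsmul_eq_mul, mul_one] at hev
  have : ((q ^ 2 : ℕ) : ℤ) ∣ (L.card : ℤ) := ⟨eval 1 H, by rw [hev]; push_cast; ring⟩
  exact_mod_cast this

/-- Injective sums together with a size bound give a tiling. -/
lemma aux_tile (n : ℕ) [NeZero n] (S T : Finset (ZMod n)) (hc : n ≤ S.card * T.card)
    (hinj : ∀ s ∈ S, ∀ s' ∈ S, ∀ t ∈ T, ∀ t' ∈ T, s + t = s' + t' → s = s') :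
    IsTile n S := by
  refine ⟨T, fun g => ?_⟩
  have hi : Set.InjOn (fun x : ZMod n × ZMod n => x.1 + x.2) (S ×ˢ T : Finset _) := by
    rintro ⟨s, t⟩ h1 ⟨s', t'⟩ h2 he
    simp only [Finset.coe_product, Set.mem_prod, Finset.mem_coe] at h1 h2
    have hs := hinj s h1.1 s' h2.1 t h1.2 t' h2.2 he
    subst hs
    simpa using he
  have hu : (S ×ˢ T).image (fun x : ZMod n × ZMod n => x.1 + x.2) = Finset.univ := by
    apply Finset.eq_univ_of_card
    apply le_antisymm (Finset.card_le_univ _)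
    rw [Finset.card_image_of_injOn hi, Finset.card_product, ZMod.card]
    exact hc
  have hg := Finset.mem_univ g
  rw [← hu, Finset.mem_image] at hg
  obtain ⟨x, hx, hxg⟩ := hg
  have hx' := Finset.mem_product.mp hx
  refine ⟨x, ⟨hx'.1, hx'.2, hxg⟩, ?_⟩
  rintro y ⟨h1, h2, h3⟩
  exact hi (Finset.mem_coe.mpr (Finset.mem_product.mpr ⟨h1, h2⟩)) hx (h3.trans hxg.symm)

lemma aux_T (n q d : ℕ) (hd : 0 < d) (hle : q * d ≤ n) :
    ((Finset.range q).image (fun j => ((j * d : ℕ) : ZMod n))).card = q := by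
  rw [Finset.card_image_of_injOn, Finset.card_range]
  intro i hi j hj he
  simp only [Finset.coe_range, Set.mem_Iio] at hi hj
  have he' := (ZMod.natCast_eq_natCast_iff' _ _ _).mp he
  rw [Nat.mod_eq_of_lt (lt_of_lt_of_le (Nat.mul_lt_mul_of_pos_right hi hd) hle),
    Nat.mod_eq_of_lt (lt_of_lt_of_le (Nat.mul_lt_mul_of_pos_right hj hd) hle)] at he'
  exact Nat.eq_of_mul_eq_mul_right hd he'

lemma aux_main (n m q : ℕ) (hn : n = m * q ^ 2) (hm : 0 < m) (hq : q.Prime)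
    (S L : Finset (ZMod n)) (h : SpectralPair n S L) (hle : m * q ≤ S.card)
    (hnd : ¬ q ^ 2 ∣ S.card) : IsTile n S := by
  have hq0 := hq.pos
  have hnpos : 0 < n := by
    rw [hn]
    positivity
  have : NeZero n := ⟨hnpos.ne'⟩
  by_cases h1 : ∃ s ∈ S, ∃ t ∈ S, s ≠ t ∧ (q : ZMod n) * (s - t) = 0
  · obtain ⟨s, hs, t, ht, hst, hz⟩ := h1
    have h2 : ∀ u ∈ S, ∀ v ∈ S, ((q ^ 2 : ℕ) : ZMod n) * (u - v) = 0 →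
        (q : ZMod n) * (u - v) = 0 := by
      intro u hu v hv huv
      by_contra hne
      apply hnd
      rw [← h.1]
      refine aux_dvd n q hq L (s - t) (u - v) (sub_ne_zero.mpr hst) hz hne huv
        (aux_dual n S L h s t hs ht hst) (aux_dual n S L h u v hu hv ?_)
      rintro rfl
      simp at hne
    have hqm : q * m ≤ n := by
      rw [hn]
      nlinarith [Nat.mul_le_mul_left (m * q) hq0]
    refine aux_tile n S ((Finset.range q).image (fun j => ((j * m : ℕ) : ZMod n))) ?_ ?_
    · rw [aux_T n q m hm hqm]
      calc n = m * q * q := by rw [hn]; ring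
        _ ≤ _ := Nat.mul_le_mul_right q hle
    · intro u hu v hv x hx y hy he
      rw [Finset.mem_image] at hx hy
      obtain ⟨i, hi, rfl⟩ := hx
      obtain ⟨j, hj, rfl⟩ := hy
      rw [Finset.mem_range] at hi hj
      have hd : u - v = ((j * m : ℕ) : ZMod n) - ((i * m : ℕ) : ZMod n) := by
        linear_combination he
      have hN : (m : ZMod n) * (q : ZMod n) ^ 2 = 0 := by
        have hz' : ((m * q ^ 2 : ℕ) : ZMod n) = 0 :=
          (ZMod.natCast_eq_zero_iff _ _).mpr (dvd_of_eq hn)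
        exact_mod_cast hz'
      have h3 := h2 u hu v hv (by
        rw [hd]
        push_cast
        linear_combination ((j : ZMod n) - i) * hN)
      rw [hd] at h3
      have h4 : ((q * (j * m) : ℕ) : ZMod n) = ((q * (i * m) : ℕ) : ZMod n) := by
        push_cast at h3 ⊢
        linear_combination h3
      rw [ZMod.natCast_eq_natCast_iff', Nat.mod_eq_of_lt, Nat.mod_eq_of_lt] at h4
      · have h5 := Nat.eq_of_mul_eq_mul_right hm (Nat.eq_of_mul_eq_mul_left hq0 h4)
        subst h5
        simpa using he
      · rw [hn]
        calc q * (i * m) = (q * m) * i := by ring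
          _ < (q * m) * q := Nat.mul_lt_mul_of_pos_left hi (by positivity)
          _ = _ := by ring
      · rw [hn]
        calc q * (j * m) = (q * m) * j := by ring
          _ < (q * m) * q := Nat.mul_lt_mul_of_pos_left hj (by positivity)
          _ = _ := by ring
  · push Not at h1
    have hmq : q * (m * q) ≤ n := by
      rw [hn]
      apply le_of_eq
      ring
    refine aux_tile n S ((Finset.range q).image (fun j => ((j * (m * q) : ℕ) : ZMod n))) ?_ ?_
    · rw [aux_T n q (m * q) (by positivity) hmq]
      calc n = m * q * q := by rw [hn]; ring
        _ ≤ _ := Nat.mul_le_mul_right q hle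
    · intro u hu v hv x hx y hy he
      rw [Finset.mem_image] at hx hy
      obtain ⟨i, hi, rfl⟩ := hx
      obtain ⟨j, hj, rfl⟩ := hy
      by_contra hne
      apply h1 u hu v hv hne
      have hN : (m : ZMod n) * (q : ZMod n) ^ 2 = 0 := by
        have hz' : ((m * q ^ 2 : ℕ) : ZMod n) = 0 :=
          (ZMod.natCast_eq_zero_iff _ _).mpr (dvd_of_eq hn)
        exact_mod_cast hz'
      push_cast at he
      linear_combination (q : ZMod n) * he + ((j : ZMod n) - i) * hN

theorem p2qr_case_tiles
    (p q r : ℕ) (hp : p.Prime) (hq : q.Prime) (hr : r.Prime)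
    (hpq : p ≠ q) (hpr : p ≠ r) (hqr : q ≠ r)
    (S Λ : Finset (ZMod (p ^ 2 * q ^ 2 * r)))
    (h : SpectralPair (p ^ 2 * q ^ 2 * r) S Λ)
    (hgcd : Nat.gcd S.card (p ^ 2 * q ^ 2 * r) = p ^ 2 * q * r) :
    IsTile (p ^ 2 * q ^ 2 * r) S := by
  have hm : 0 < p ^ 2 * r := Nat.mul_pos (pow_pos hp.pos 2) hr.pos
  have hcop : ¬ q ∣ p ^ 2 * r := by
    intro hd
    rcases (Nat.Prime.dvd_mul hq).mp hd with h1 | h1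
    · exact hpq ((Nat.prime_dvd_prime_iff_eq hq hp).mp (hq.dvd_of_dvd_pow h1)).symm
    · exact hqr ((Nat.prime_dvd_prime_iff_eq hq hr).mp h1)
  have hnd : ¬ q ^ 2 ∣ S.card := by
    intro hd
    have h1 : q ^ 2 ∣ p ^ 2 * q * r := by
      rw [← hgcd]
      exact Nat.dvd_gcd hd ⟨p ^ 2 * r, by ring⟩
    apply hcop
    apply Nat.dvd_of_mul_dvd_mul_left hq.pos
    calc q * q = q ^ 2 := by ring
      _ ∣ p ^ 2 * q * r := h1
      _ = q * (p ^ 2 * r) := by ring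
  have hpos : 0 < S.card := by
    rcases Nat.eq_zero_or_pos S.card with h0 | h0
    · rw [h0] at hnd
      exact absurd (dvd_zero _) hnd
    · exact h0
  have hle : p ^ 2 * r * q ≤ S.card := by
    apply Nat.le_of_dvd hpos
    have := Nat.gcd_dvd_left S.card (p ^ 2 * q ^ 2 * r)
    rw [hgcd] at this
    rwa [show p ^ 2 * r * q = p ^ 2 * q * r by ring]
  exact aux_main _ (p ^ 2 * r) q (by ring) hm hq S Λ h hle hnd
end
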